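/- Let R be a regular local ring. Then R is a unique factorization domain. -/

import Mathlib

open IsLocalRing CategoryTheory
universe u

theorem Ideal.isPrincipal_of_free_prod {S : Type*} [CommRing S] [IsDomain S] (I : Ideal S)
    (N : Type*) [AddCommGroup N] [Module S N] [Module.Free S N] [Module.Finite S N]
    [Module.Finite S I] [Module.Free S (I × N)] : Submodule.IsPrincipal I := by
  by_cases hI : I = ⊥
  · subst hI; infer_instance
  have hrank : Module.finrank S (S × N) = Module.finrank S (I × N) := by
    obtain ⟨i, hi, hi0⟩ := Submodule.exists_mem_ne_zero_of_ne_bot hI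
    refine le_antisymm
      (LinearMap.finrank_le_finrank_of_injective
        (f := (LinearMap.toSpanSingleton S I ⟨i, hi⟩).prodMap (LinearMap.id (M := N))) ?_)
      (LinearMap.finrank_le_finrank_of_injective
        (f := I.subtype.prodMap (LinearMap.id (M := N))) ?_)
    · rw [LinearMap.coe_prodMap]
      refine Function.Injective.prodMap ?_ Function.injective_id
      intro a b hab
      exact mul_right_cancel₀ hi0 (congrArg Subtype.val hab)
    · rw [LinearMap.coe_prodMap]
      exact Function.Injective.prodMap I.injective_subtype Function.injective_id
  let e : (S × N) ≃ₗ[S] (I × N) := LinearEquiv.ofFinrankEq _ _ hrank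
  let B : (S × N) →ₗ[S] (S × N) := (I.subtype.prodMap LinearMap.id) ∘ₗ e.toLinearMap
  have hmem : LinearMap.det B ∈ I := by
    classical
    let b := (Module.Basis.singleton Unit S).prod (Module.Free.chooseBasis S N)
    rw [← LinearMap.det_toMatrix b, ← Ideal.Quotient.eq_zero_iff_mem, RingHom.map_det]
    refine Matrix.det_eq_zero_of_row_eq_zero (Sum.inl ()) fun j ↦ ?_
    simp only [RingHom.mapMatrix_apply, Matrix.map_apply, LinearMap.toMatrix_apply]
    rw [Ideal.Quotient.eq_zero_iff_mem]
    simp [b, B]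
  refine ⟨LinearMap.det B, le_antisymm (fun i hi ↦ ?_) ?_⟩
  · let f : (S × N) →ₗ[S] (I × N) := (LinearMap.toSpanSingleton S I ⟨i, hi⟩).prodMap LinearMap.id
    have h : B ∘ₗ (e.symm.toLinearMap ∘ₗ f) = (LinearMap.mulLeft S i).prodMap LinearMap.id := by
      ext <;> simp [B, f]
    have h2 := congrArg LinearMap.det h
    rw [LinearMap.det_comp, LinearMap.det_prodMap] at h2
    simp at h2
    exact Ideal.mem_span_singleton'.mpr ⟨_, (mul_comm _ _).trans h2⟩
  · exact (Submodule.span_singleton_le_iff_mem _ _).mpr hmem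

section ProjDim

variable {R : Type u} [CommRing R]

/-- The `R`-module `M` has projective dimension at most `n`. -/
abbrev ProjDimLE (R : Type u) [CommRing R] (M : Type u) [AddCommGroup M] [Module R M] (n : ℕ) :
    Prop :=
  HasProjectiveDimensionLE (ModuleCat.of R M) n

variable {M N F : Type u} [AddCommGroup M] [Module R M] [AddCommGroup N] [Module R N]
  [AddCommGroup F] [Module R F]

theorem projDimLE_zero_iff : ProjDimLE R M 0 ↔ Module.Projective R M := by
  rw [ProjDimLE, ← projective_iff_hasProjectiveDimensionLE_zero, ← IsProjective.iff_projective]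

theorem projDimLE_succ_iff_ker [Module.Projective R F] {f : F →ₗ[R] M}
    (hf : Function.Surjective f) (n : ℕ) :
    ProjDimLE R M (n + 1) ↔ ProjDimLE R (LinearMap.ker f) n :=
  (LinearMap.shortExact_shortComplexKer hf).hasProjectiveDimensionLT_X₃_iff n
    ((IsProjective.iff_projective (R := R) F).mp inferInstance)

theorem ProjDimLE.of_equiv {n : ℕ} (h : ProjDimLE R M n) (e : M ≃ₗ[R] N) : ProjDimLE R N n :=
  hasProjectiveDimensionLT_of_iso e.toModuleIso (n + 1)

theorem ProjDimLE.of_retract {n : ℕ} (h : ProjDimLE R M n) (i : N →ₗ[R] M) (p : M →ₗ[R] N)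
    (hip : p ∘ₗ i = LinearMap.id) : ProjDimLE R N n :=
  Retract.hasProjectiveDimensionLT (Y := ModuleCat.of R M)
    { i := ModuleCat.ofHom i, r := ModuleCat.ofHom p
      retract := by rw [← ModuleCat.ofHom_comp, hip]; rfl } (n + 1)

/-- A projective quotient of a finite free module is stably free if the kernel is. -/
theorem Module.IsStablyFree.of_exact {A K F M : Type*} [CommRing A] [AddCommGroup K] [Module A K]
    [AddCommGroup F] [Module A F] [AddCommGroup M] [Module A M] [Module.Finite A K]
    [Module.Finite A F] [Module.Free A F] [Module.Projective A M] {j : K →ₗ[A] F} {g : F →ₗ[A] M}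
    (hj : Function.Injective j) (hg : Function.Surjective g) (hjg : Function.Exact j g)
    (hK : Module.Projective A K → Module.IsStablyFree A K) : Module.IsStablyFree A M := by
  obtain ⟨s, hs⟩ := Module.projective_lifting_property g LinearMap.id hg
  have e : (K × M) ≃ₗ[A] F :=
    lequivProdOfRightSplitExact hj (LinearMap.exact_iff.mp hjg).symm hs
  have hK' : Module.Projective A K :=
    have := Module.Projective.of_equiv e.symm
    .of_split (LinearMap.inl _ _ _) (LinearMap.fst _ _ M) (by ext; rfl)
  have := hK hK'
  obtain ⟨Q, _, _, _, _, hfree⟩ := Module.IsStablyFree.exist_free_prod A K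
  have e' : (F × Q) ≃ₗ[A] (M × (K × Q)) :=
    ((e.symm ≪≫ₗ LinearEquiv.prodComm _ _ _).prodCongr (LinearEquiv.refl _ Q)) ≪≫ₗ
      LinearEquiv.prodAssoc _ _ _ _
  have := Module.Free.of_equiv e'
  exact .of_free_prod _ _ (K × Q)

theorem ProjDimLE.isStablyFree_localizedModule [IsLocalRing R] [IsNoetherianRing R]
    [Module.Finite R M] {n : ℕ} (h : ProjDimLE R M n) (S : Submonoid R)
    [Module.Projective (Localization S) (LocalizedModule S M)] :
    Module.IsStablyFree (Localization S) (LocalizedModule S M) := by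
  induction n generalizing M with
  | zero =>
    rw [projDimLE_zero_iff] at h
    have : Module.Free R M := Module.free_of_flat_of_isLocalRing
    have := Module.free_of_isLocalizedModule (Rₛ := Localization S) S
      (LocalizedModule.mkLinearMap S M)
    infer_instance
  | succ n ih =>
    obtain ⟨k, f, hf⟩ := Module.Finite.exists_fin' R M
    rw [projDimLE_succ_iff_ker hf] at h
    have := Module.free_of_isLocalizedModule (Rₛ := Localization S) S
      (LocalizedModule.mkLinearMap S (Fin k → R))
    exact .of_exact (LocalizedModule.map_injective S _ (LinearMap.ker f).injective_subtype)
      (LocalizedModule.map_surjective S _ hf)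
      (LocalizedModule.map_exact S _ _ (LinearMap.exact_subtype_ker_map f)) fun _ ↦ ih h

end ProjDim

section Quotient

variable {R : Type*} [CommRing R] [IsLocalRing R]

theorem IsLocalRing.quotient_span_singleton {x : R} (hx : x ∈ maximalIdeal R) :
    IsLocalRing (R ⧸ Ideal.span {x}) :=
  have : Nontrivial (R ⧸ Ideal.span {x}) :=
    Ideal.Quotient.nontrivial_iff.mpr (by simpa [Ideal.span_singleton_eq_top] using hx)
  .of_surjective' _ Ideal.Quotient.mk_surjective

theorem IsLocalRing.comap_mk_maximalIdeal (I : Ideal R) [IsLocalRing (R ⧸ I)] :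
    (maximalIdeal (R ⧸ I)).comap (Ideal.Quotient.mk I) = maximalIdeal R :=
  have := Ideal.comap_isMaximal_of_surjective _ (Ideal.Quotient.mk_surjective (I := I))
    (K := maximalIdeal (R ⧸ I))
  eq_maximalIdeal this

theorem IsLocalRing.map_mk_maximalIdeal (I : Ideal R) [IsLocalRing (R ⧸ I)] :
    (maximalIdeal R).map (Ideal.Quotient.mk I) = maximalIdeal (R ⧸ I) := by
  rw [← comap_mk_maximalIdeal I, Ideal.map_comap_of_surjective _ Ideal.Quotient.mk_surjective]

theorem IsLocalRing.maximalIdeal_eq_bot_of_le_sq [IsNoetherianRing R]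
    (h : maximalIdeal R ≤ maximalIdeal R ^ 2) : maximalIdeal R = ⊥ :=
  Submodule.eq_bot_of_le_smul_of_le_jacobson_bot (maximalIdeal R) _ (IsNoetherian.noetherian _)
    (by rwa [smul_eq_mul, ← pow_two]) (jacobson_eq_maximalIdeal _ bot_ne_top).ge

/-- Dividing by an element of `𝔪 \ 𝔪²` lowers the embedding dimension. -/
theorem IsLocalRing.spanFinrank_maximalIdeal_quotient_add_one_le [IsNoetherianRing R] {x : R}
    (hx : x ∈ maximalIdeal R) (hx2 : x ∉ maximalIdeal R ^ 2)
    [IsLocalRing (R ⧸ Ideal.span {x})] :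
    (maximalIdeal (R ⧸ Ideal.span {x})).spanFinrank + 1 ≤ (maximalIdeal R).spanFinrank := by
  classical
  obtain ⟨s, hcard, hs⟩ := (IsNoetherian.noetherian
    (maximalIdeal R)).exists_span_finset_card_eq_spanFinrank
  have hx' := hx
  rw [← hs, Submodule.mem_span_finset] at hx'
  obtain ⟨c, -, hc⟩ := hx'
  have hsm : ∀ i ∈ s, i ∈ maximalIdeal R := fun i hi ↦ hs ▸ Submodule.subset_span hi
  obtain ⟨i, hi, hci⟩ : ∃ i ∈ s, IsUnit (c i) := by
    by_contra! h
    refine hx2 (hc ▸ Submodule.sum_mem _ fun i hi ↦ ?_)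
    rw [pow_two]
    exact Ideal.mul_mem_mul (h i hi) (hsm i hi)
  have hle : maximalIdeal (R ⧸ Ideal.span {x}) =
      Ideal.span ((s.erase i).image (Ideal.Quotient.mk (Ideal.span {x}))) := by
    rw [← map_mk_maximalIdeal, Finset.coe_image, ← Ideal.map_span]
    refine le_antisymm ?_ (Ideal.map_mono ?_)
    · rw [← hs, Ideal.map_le_iff_le_comap, Submodule.span_le]
      intro j hj
      have key : ∀ j ∈ s.erase i, Ideal.Quotient.mk (Ideal.span {x}) j ∈
          (Ideal.span ((s.erase i : Finset R) : Set R)).map (Ideal.Quotient.mk (Ideal.span {x})) :=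
        fun j hj ↦ Ideal.mem_map_of_mem _ (Ideal.subset_span hj)
      by_cases hji : j = i
      · subst hji
        have h0 : Ideal.Quotient.mk (Ideal.span {x}) x = 0 :=
          Ideal.Quotient.eq_zero_iff_mem.mpr (Ideal.mem_span_singleton_self x)
        have h1 := congrArg (Ideal.Quotient.mk (Ideal.span {x})) hc
        rw [h0, ← Finset.add_sum_erase s _ hi, map_add, smul_eq_mul, map_mul,
          add_eq_zero_iff_eq_neg] at h1
        rw [SetLike.mem_coe, Ideal.mem_comap,
          ← Ideal.unit_mul_mem_iff_mem _ (hci.map (Ideal.Quotient.mk (Ideal.span {x})))]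
        rw [h1, map_sum, neg_mem_iff]
        refine Submodule.sum_mem _ fun k hk ↦ ?_
        rw [smul_eq_mul, map_mul]
        exact Ideal.mul_mem_left _ _ (key k hk)
      · exact key j (Finset.mem_erase.mpr ⟨hji, hj⟩)
    · rw [Ideal.span_le]
      exact fun j hj ↦ hsm j (Finset.mem_of_mem_erase hj)
  rw [hle, ← hcard, ← Finset.card_erase_add_one hi]
  refine Nat.add_le_add_right ?_ 1
  refine (Submodule.spanFinrank_span_le_ncard_of_finite (Finset.finite_toSet _)).trans ?_
  rw [Set.ncard_coe_finset]
  exact Finset.card_image_le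

/-- Dividing by one element lowers the embedding dimension by at most one. -/
theorem IsLocalRing.spanFinrank_maximalIdeal_le_quotient_add_one [IsNoetherianRing R] (x : R)
    [IsLocalRing (R ⧸ Ideal.span {x})] :
    (maximalIdeal R).spanFinrank ≤ (maximalIdeal (R ⧸ Ideal.span {x})).spanFinrank + 1 := by
  classical
  obtain ⟨s, hcard, hs⟩ := (IsNoetherian.noetherian
    (maximalIdeal (R ⧸ Ideal.span {x}))).exists_span_finset_card_eq_spanFinrank
  have : maximalIdeal R = Ideal.span (insert x (s.image Quotient.out) : Finset R) := by
    have h1 : (Ideal.span (s.image Quotient.out : Finset R) : Ideal R).map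
        (Ideal.Quotient.mk (Ideal.span {x})) = maximalIdeal (R ⧸ Ideal.span {x}) := by
      rw [Ideal.map_span, Finset.coe_image, Set.image_image]
      simp only [Ideal.Quotient.mk_out, Set.image_id']
      exact hs
    rw [Finset.coe_insert, Ideal.span_insert, ← comap_mk_maximalIdeal (Ideal.span {x}), ← h1,
      Ideal.comap_map_of_surjective' _ Ideal.Quotient.mk_surjective, Ideal.mk_ker, sup_comm]
  rw [this, ← hcard]
  refine (Submodule.spanFinrank_span_le_ncard_of_finite (Finset.finite_toSet _)).trans ?_
  rw [Set.ncard_coe_finset]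
  exact (Finset.card_insert_le _ _).trans (Nat.add_le_add_right Finset.card_image_le 1)

end Quotient

section Regular

variable {R : Type*} [CommRing R]

theorem IsRegularLocalRing.quotient_span_singleton [IsRegularLocalRing R] {x : R}
    (hx : x ∈ maximalIdeal R) (hx2 : x ∉ maximalIdeal R ^ 2) :
    IsRegularLocalRing (R ⧸ Ideal.span {x}) := by
  have := IsLocalRing.quotient_span_singleton hx
  refine .of_spanFinrank_maximalIdeal_le _ ?_
  have h1 := spanFinrank_maximalIdeal_quotient_add_one_le hx hx2
  have h2 := (isRegularLocalRing_iff R).mp inferInstance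
  have h3 : ringKrullDim R ≤ ringKrullDim (R ⧸ Ideal.span {x}) + 1 := by
    simpa using ringKrullDim_le_ringKrullDim_quotient_add_encard {x}
      (by simpa [ringJacobson_eq_maximalIdeal] using hx)
  rw [← h2] at h3
  have h4 := (Nat.cast_le (α := WithBot ℕ∞)).mpr h1
  rw [Nat.cast_add, Nat.cast_one] at h4
  exact (ENat.WithBot.add_le_add_one_right_iff).mp (h4.trans h3)

theorem Ideal.eq_bot_of_le_span_singleton_of_notMem [IsLocalRing R] [IsNoetherianRing R]
    (p : Ideal R) [p.IsPrime] {x : R} (hx : x ∈ maximalIdeal R) (hxp : x ∉ p)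
    (hp : p ≤ Ideal.span {x}) : p = ⊥ := by
  refine Submodule.eq_bot_of_le_smul_of_le_jacobson_bot (Ideal.span {x}) _
    (IsNoetherian.noetherian _) (fun y hy ↦ ?_)
    ((Ideal.span_singleton_le_iff_mem _).mpr ((jacobson_eq_maximalIdeal _ bot_ne_top).ge hx))
  obtain ⟨z, rfl⟩ := Ideal.mem_span_singleton.mp (hp hy)
  exact Ideal.mul_mem_mul (Ideal.mem_span_singleton_self x)
    ((Ideal.IsPrime.mem_or_mem ‹_› hy).resolve_left hxp)

/-- Prime avoidance for `𝔪 \ 𝔪²`. -/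
theorem IsLocalRing.exists_mem_notMem_sq_notMem [IsLocalRing R] [IsNoetherianRing R]
    (hm : maximalIdeal R ≠ ⊥) {s : Set (Ideal R)} (hs : s.Finite) (hprime : ∀ p ∈ s, p.IsPrime)
    (hmax : maximalIdeal R ∉ s) :
    ∃ x ∈ maximalIdeal R, x ∉ maximalIdeal R ^ 2 ∧ ∀ p ∈ s, x ∉ p := by
  classical
  by_contra! h
  have key := (Ideal.subset_union_prime (s := insert (maximalIdeal R ^ 2) hs.toFinset)
    (f := fun I ↦ I) (maximalIdeal R ^ 2) (maximalIdeal R ^ 2) (I := maximalIdeal R) ?_).mp ?_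
  · obtain ⟨p, hp, hle⟩ := key
    rcases Finset.mem_insert.mp hp with rfl | hp
    · exact hm (maximalIdeal_eq_bot_of_le_sq hle)
    · have hps := hs.mem_toFinset.mp hp
      have := (maximalIdeal.isMaximal R).eq_of_le (hprime p hps).ne_top hle
      exact hmax (this ▸ hps)
  · intro p hp h1 _
    exact hprime p (hs.mem_toFinset.mp (Finset.mem_of_mem_insert_of_ne hp h1))
  · intro x hx
    by_cases hx2 : x ∈ maximalIdeal R ^ 2
    · exact Set.mem_biUnion (by simp) hx2
    · obtain ⟨p, hp, hxp⟩ := h x hx hx2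
      exact Set.mem_biUnion (by simp [hp]) hxp

variable (R) in
theorem IsRegularLocalRing.isDomain [IsRegularLocalRing R] : IsDomain R := by
  obtain ⟨n, hn⟩ : ∃ n, (maximalIdeal R).spanFinrank ≤ n := ⟨_, le_rfl⟩
  induction n generalizing R with
  | zero =>
    have := (Submodule.spanFinrank_eq_zero_iff_eq_bot (IsNoetherian.noetherian _)).mp
      (Nat.le_zero.mp hn)
    exact ((isField_iff_maximalIdeal_eq).mpr this).isDomain
  | succ n ih =>
    by_cases hm : maximalIdeal R = ⊥
    · exact ((isField_iff_maximalIdeal_eq).mpr hm).isDomain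
    have hmin : maximalIdeal R ∉ minimalPrimes R := by
      intro h
      have h1 := (isRegularLocalRing_iff R).mp inferInstance
      rw [← maximalIdeal_height_eq_ringKrullDim, Ideal.height_eq_zero_iff.mpr h] at h1
      refine hm ((Submodule.spanFinrank_eq_zero_iff_eq_bot (IsNoetherian.noetherian _)).mp ?_)
      exact_mod_cast h1
    obtain ⟨x, hx, hx2, hxp⟩ := exists_mem_notMem_sq_notMem hm
      (minimalPrimes.finite_of_isNoetherianRing R) (fun p hp ↦ hp.1.1) hmin
    have := IsRegularLocalRing.quotient_span_singleton hx hx2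
    have hdom := ih (R := R ⧸ Ideal.span {x})
      (by have := spanFinrank_maximalIdeal_quotient_add_one_le hx hx2; lia)
    have hprime := (Ideal.Quotient.isDomain_iff_prime _).mp hdom
    obtain ⟨p, hp, hle⟩ := Ideal.exists_minimalPrimes_le (bot_le (a := Ideal.span {x}))
    have := hp.1.1
    have hbot := p.eq_bot_of_le_span_singleton_of_notMem hx (hxp p hp) hle
    subst hbot
    exact IsDomain.of_bot_isPrime R

theorem IsRegularLocalRing.prime_of_notMem_sq [IsRegularLocalRing R] {x : R}
    (hx : x ∈ maximalIdeal R) (hx2 : x ∉ maximalIdeal R ^ 2) : Prime x := by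
  have := IsRegularLocalRing.quotient_span_singleton hx hx2
  have := IsRegularLocalRing.isDomain (R ⧸ Ideal.span {x})
  rw [← Ideal.span_singleton_prime (by rintro rfl; exact hx2 (zero_mem _))]
  exact (Ideal.Quotient.isDomain_iff_prime _).mp this

end Regular

section Quotient

variable {R : Type u} [CommRing R]

theorem QuotSMulTop.map_subtype_ker_injective {x : R} {M N : Type*} [AddCommGroup M] [Module R M]
    [AddCommGroup N] [Module R N] (hN : IsSMulRegular N x) (f : M →ₗ[R] N) :
    Function.Injective (QuotSMulTop.map x (LinearMap.ker f).subtype) := by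
  rw [← LinearMap.ker_eq_bot, LinearMap.ker_eq_bot']
  intro y hy
  obtain ⟨k, rfl⟩ := Submodule.Quotient.mk_surjective _ y
  rw [QuotSMulTop.map_apply_mk, Submodule.Quotient.mk_eq_zero,
    Submodule.mem_smul_pointwise_iff_exists] at hy
  obtain ⟨w, -, hw⟩ := hy
  have hfw : f w = 0 := hN.right_eq_zero_of_smul (by
    rw [← map_smul, hw]; exact k.2)
  rw [Submodule.Quotient.mk_eq_zero, Submodule.mem_smul_pointwise_iff_exists]
  exact ⟨⟨w, hfw⟩, trivial, Subtype.ext hw⟩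

/-- Change of rings modulo a regular element. -/
theorem projDimLE_quotSMulTop_iff [IsLocalRing R] [IsNoetherianRing R] {x : R}
    (hx : x ∈ maximalIdeal R) (hreg : IsSMulRegular R x) {N : Type u} [AddCommGroup N]
    [Module R N] [Module.Finite R N] (hN : IsSMulRegular N x) (n : ℕ) :
    ProjDimLE R N n ↔ ProjDimLE (R ⧸ Ideal.span {x}) (QuotSMulTop x N) n := by
  have : IsLocalRing (R ⧸ Ideal.span {x}) := IsLocalRing.quotient_span_singleton hx
  have hfree : ∀ (N : Type u) [AddCommGroup N] [Module R N] [Module.Finite R N],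
      IsSMulRegular N x →
        (Module.Projective R N ↔ Module.Projective (R ⧸ Ideal.span {x}) (QuotSMulTop x N)) := by
    intro N _ _ _ hN
    have := Module.finitePresentation_of_finite R N
    have hiff := Module.free_quotSMulTop_iff_free R N (x := x)
      ((jacobson_eq_maximalIdeal _ bot_ne_top).ge hx) hN
    have : Module.Finite (R ⧸ Ideal.span {x}) (QuotSMulTop x N) :=
      .of_restrictScalars_finite R _ _
    refine ⟨fun h ↦ ?_, fun h ↦ ?_⟩
    · have := hiff.mpr Module.free_of_flat_of_isLocalRing
      infer_instance
    · have := hiff.mp Module.free_of_flat_of_isLocalRing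
      infer_instance
  induction n generalizing N with
  | zero => rw [projDimLE_zero_iff, projDimLE_zero_iff, hfree N hN]
  | succ n ih =>
    obtain ⟨k, f, hf⟩ := Module.Finite.exists_fin' R N
    have hF : IsSMulRegular (Fin k → R) x := .pi fun _ ↦ hreg
    let f' := (QuotSMulTop.map x f).extendScalarsOfSurjective
      (Ideal.Quotient.mk_surjective (I := Ideal.span {x}))
    have hf' : Function.Surjective f' := QuotSMulTop.map_surjective x hf
    have := (hfree _ hF).mp inferInstance
    rw [projDimLE_succ_iff_ker hf, projDimLE_succ_iff_ker hf']
    refine (ih (N := LinearMap.ker f) (hF.submodule _ _)).trans ?_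
    let g := (QuotSMulTop.map x (LinearMap.ker f).subtype).extendScalarsOfSurjective
      (Ideal.Quotient.mk_surjective (I := Ideal.span {x}))
    have hg : Function.Injective g := QuotSMulTop.map_subtype_ker_injective hN f
    have hgf : Function.Exact g f' :=
      QuotSMulTop.map_exact x (LinearMap.exact_subtype_ker_map f) hf
    let e := (LinearEquiv.ofInjective g hg) ≪≫ₗ
      LinearEquiv.ofEq _ _ (LinearMap.exact_iff.mp hgf).symm
    exact ⟨fun h ↦ h.of_equiv e, fun h ↦ h.of_equiv e.symm⟩

end Quotient

/-- Finitely generated modules over a regular local ring have finite projective dimension. -/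
theorem IsRegularLocalRing.exists_projDimLE (R : Type u) [CommRing R] [IsRegularLocalRing R]
    (M : Type u) [AddCommGroup M] [Module R M] [Module.Finite R M] : ∃ n, ProjDimLE R M n := by
  obtain ⟨n, hn⟩ : ∃ n, (maximalIdeal R).spanFinrank ≤ n := ⟨_, le_rfl⟩
  induction n generalizing R M with
  | zero =>
    have h := (Submodule.spanFinrank_eq_zero_iff_eq_bot (IsNoetherian.noetherian _)).mp
      (Nat.le_zero.mp hn)
    let := ((isField_iff_maximalIdeal_eq).mpr h).toField
    refine ⟨0, projDimLE_zero_iff.mpr ?_⟩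
    have : Module.Free R M := Module.Free.of_divisionRing R M
    infer_instance
  | succ n ih =>
    have := IsRegularLocalRing.isDomain R
    by_cases hm : maximalIdeal R ≤ maximalIdeal R ^ 2
    · refine ih R M ?_
      rw [maximalIdeal_eq_bot_of_le_sq hm, Submodule.spanFinrank_bot]
      exact n.zero_le
    obtain ⟨x, hx, hx2⟩ := SetLike.not_le_iff_exists.mp hm
    have hx0 : IsSMulRegular R x :=
      IsSMulRegular.of_ne_zero (by rintro rfl; exact hx2 (zero_mem _))
    have := IsRegularLocalRing.quotient_span_singleton hx hx2
    obtain ⟨k, f, hf⟩ := Module.Finite.exists_fin' R M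
    have hF : IsSMulRegular (Fin k → R) x := .pi fun _ ↦ hx0
    have : Module.Finite (R ⧸ Ideal.span {x}) (QuotSMulTop x (LinearMap.ker f)) :=
      .of_restrictScalars_finite R _ _
    obtain ⟨m, hm⟩ := ih (R ⧸ Ideal.span {x}) (QuotSMulTop x (LinearMap.ker f))
      (by have := spanFinrank_maximalIdeal_quotient_add_one_le hx hx2; lia)
    exact ⟨m + 1, (projDimLE_succ_iff_ker hf m).mpr
      ((projDimLE_quotSMulTop_iff hx hx0 (hF.submodule _ _) m).mpr hm)⟩

theorem Module.Free.subsingleton_of_forall_smul_eq_zero {R M : Type*} [CommRing R] [AddCommGroup M]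
    [Module R M] [Module.Free R M] {y : R} (hy : y ≠ 0) (h : ∀ m : M, y • m = 0) :
    Subsingleton M := by
  let c := Module.Free.chooseBasis R M
  have : IsEmpty (Module.Free.ChooseBasisIndex R M) :=
    ⟨fun i ↦ hy (by simpa using congrArg (fun w ↦ c.repr w i) (h (c i)))⟩
  exact c.repr.toEquiv.subsingleton

section Serre

variable {R : Type u} [CommRing R] [IsLocalRing R] [IsNoetherianRing R]

/-- Over a local ring of depth zero, modules of finite projective dimension are free. -/
theorem ProjDimLE.free_of_forall_mul_eq_zero {y : R} (hy : y ≠ 0)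
    (hym : ∀ r ∈ maximalIdeal R, y * r = 0) {M : Type u} [AddCommGroup M] [Module R M]
    [Module.Finite R M] {n : ℕ} (h : ProjDimLE R M n) : Module.Free R M := by
  induction n generalizing M with
  | zero =>
    rw [projDimLE_zero_iff] at h
    exact Module.free_of_flat_of_isLocalRing
  | succ n ih =>
    let b := Module.finBasis (ResidueField R) (TensorProduct R (ResidueField R) M)
    choose v hv using fun i ↦ TensorProduct.mk_surjective R M (ResidueField R)
      residue_surjective (b i)
    let f := Fintype.linearCombination R v
    have hf : Function.Surjective f := by
      rw [← LinearMap.range_eq_top, Fintype.range_linearCombination]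
      exact span_eq_top_of_tmul_eq_basis v b hv
    have hker : ∀ w ∈ LinearMap.ker f, y • w = 0 := by
      intro w hw
      have h1 : ∑ i, residue R (w i) • b i = 0 := by
        have := congrArg (TensorProduct.mk R (ResidueField R) M 1) (LinearMap.mem_ker.mp hw)
        simp only [f, Fintype.linearCombination_apply, map_sum, map_zero, map_smul, hv] at this
        exact this
      have h2 := Fintype.linearIndependent_iff.mp b.linearIndependent _ h1
      ext i
      exact hym _ ((residue_eq_zero_iff _).mp (h2 i))
    have hfree := ih ((projDimLE_succ_iff_ker hf n).mp h)
    have hbot : LinearMap.ker f = ⊥ := (Submodule.subsingleton_iff_eq_bot).mp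
      (Module.Free.subsingleton_of_forall_smul_eq_zero hy fun w ↦ Subtype.ext (hker w w.2))
    exact .of_equiv (LinearEquiv.ofBijective f ⟨LinearMap.ker_eq_bot.mp hbot, hf⟩)

theorem IsLocalRing.exists_isSMulRegular_notMem_sq {n : ℕ}
    (h : ProjDimLE R (maximalIdeal R) n) (hm : maximalIdeal R ≠ ⊥) :
    ∃ x ∈ maximalIdeal R, x ∉ maximalIdeal R ^ 2 ∧ IsSMulRegular R x := by
  obtain ⟨x, hx, hx2, hxp⟩ := exists_mem_notMem_sq_notMem hm (associatedPrimes.finite R R)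
    (fun p hp ↦ hp.1) (fun hass ↦ by
      obtain ⟨-, y, hy⟩ := isAssociatedPrime_iff.mp hass
      have hym : ∀ r ∈ maximalIdeal R, y * r = 0 := by
        intro r hr
        rw [hy, Submodule.mem_colon_singleton] at hr
        simpa [mul_comm] using hr
      have hy0 : y ≠ 0 := by
        rintro rfl
        have : (1 : R) ∈ maximalIdeal R := by
          rw [hy, Submodule.mem_colon_singleton]; simp
        exact (Ideal.ne_top_iff_one _).mp (maximalIdeal.isMaximal R).ne_top this
      have hfree := h.free_of_forall_mul_eq_zero hy0 hym
      exact hm ((Submodule.subsingleton_iff_eq_bot).mp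
        (Module.Free.subsingleton_of_forall_smul_eq_zero hy0 fun w ↦ Subtype.ext (hym w w.2))))
  refine ⟨x, hx, hx2, ?_⟩
  rw [isSMulRegular_iff_right_eq_zero_of_smul]
  intro r hr
  by_contra hr0
  have : x ∈ ⋃ p ∈ associatedPrimes R R, (p : Set R) := by
    rw [biUnion_associatedPrimes_eq_zero_divisors]
    exact ⟨r, hr0, hr⟩
  obtain ⟨p, hp, hxp'⟩ := Set.mem_iUnion₂.mp this
  exact hxp p hp hxp'

theorem IsLocalRing.exists_linearMap_residueField_eq_one {x : R} (hx : x ∈ maximalIdeal R)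
    (hx2 : x ∉ maximalIdeal R ^ 2) :
    ∃ l : maximalIdeal R →ₗ[R] ResidueField R, l ⟨x, hx⟩ = 1 := by
  have hne : (maximalIdeal R).toCotangent ⟨x, hx⟩ ≠ 0 := by
    rwa [Ne, Ideal.toCotangent_eq_zero]
  obtain ⟨d, hd⟩ : ∃ d : Module.Dual (ResidueField R) (CotangentSpace R),
      d ((maximalIdeal R).toCotangent ⟨x, hx⟩) ≠ 0 := by
    by_contra! h
    exact hne ((Module.forall_dual_apply_eq_zero_iff (ResidueField R) _).mp h)
  refine ⟨(((d ((maximalIdeal R).toCotangent ⟨x, hx⟩))⁻¹ • d).restrictScalars R) ∘ₗ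
    (maximalIdeal R).toCotangent, ?_⟩
  exact inv_mul_cancel₀ hd

/-- If `x ∈ 𝔪 \ 𝔪²`, then the maximal ideal of `R ⧸ (x)` is a retract of `𝔪 ⧸ x𝔪`. -/
theorem ProjDimLE.maximalIdeal_quotient {x : R} (hx : x ∈ maximalIdeal R)
    (hx2 : x ∉ maximalIdeal R ^ 2) [IsLocalRing (R ⧸ Ideal.span {x})] {n : ℕ}
    (h : ProjDimLE (R ⧸ Ideal.span {x}) (QuotSMulTop x (maximalIdeal R)) n) :
    ProjDimLE (R ⧸ Ideal.span {x}) (maximalIdeal (R ⧸ Ideal.span {x})) n := by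
  obtain ⟨l, hl⟩ := exists_linearMap_residueField_eq_one hx hx2
  let ρ : maximalIdeal R →ₗ[R] maximalIdeal (R ⧸ Ideal.span {x}) :=
    ((Ideal.Quotient.mkₐ R (Ideal.span {x})).toLinearMap.domRestrict (maximalIdeal R)).codRestrict
      ((maximalIdeal (R ⧸ Ideal.span {x})).restrictScalars R) fun y ↦
        (comap_mk_maximalIdeal (Ideal.span {x})).ge y.2
  have hρ : Function.Surjective ρ := by
    rintro ⟨z, hz⟩
    obtain ⟨y, rfl⟩ := Ideal.Quotient.mk_surjective z
    exact ⟨⟨y, (comap_mk_maximalIdeal (Ideal.span {x})).le hz⟩, rfl⟩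
  have hρx : ρ ⟨x, hx⟩ = 0 :=
    Subtype.ext (Ideal.Quotient.eq_zero_iff_mem.mpr (Ideal.mem_span_singleton_self x))
  let q : maximalIdeal R →ₗ[R] QuotSMulTop x (maximalIdeal R) := Submodule.mkQ _
  have hq : ∀ y, q (x • y) = 0 := fun y ↦ (Submodule.Quotient.mk_eq_zero _).mpr
    (Submodule.smul_mem_pointwise_smul _ _ _ trivial)
  let t : (R ⧸ maximalIdeal R) →ₗ[R] QuotSMulTop x (maximalIdeal R) :=
    (maximalIdeal R).liftQ (LinearMap.toSpanSingleton R _ (q ⟨x, hx⟩)) fun r hr ↦ by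
      rw [LinearMap.mem_ker, LinearMap.toSpanSingleton_apply, ← map_smul,
        ← hq ⟨r, hr⟩]
      exact congrArg q (Subtype.ext (mul_comm r x))
  let σ₀ : maximalIdeal R →ₗ[R] QuotSMulTop x (maximalIdeal R) := q - t ∘ₗ l
  have hσ₀x : σ₀ ⟨x, hx⟩ = 0 := by
    have : t 1 = (1 : R) • q ⟨x, hx⟩ := rfl
    change q ⟨x, hx⟩ - t (l ⟨x, hx⟩) = 0
    rw [hl]
    exact sub_eq_zero.mpr (by rw [← one_smul R (q ⟨x, hx⟩), ← this]; rfl)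
  have hker : LinearMap.ker ρ ≤ LinearMap.ker σ₀ := by
    intro y hy
    obtain ⟨r, hr⟩ := Ideal.mem_span_singleton'.mp
      (Ideal.Quotient.eq_zero_iff_mem.mp (congrArg Subtype.val (LinearMap.mem_ker.mp hy)))
    rw [LinearMap.mem_ker, show y = r • ⟨x, hx⟩ from Subtype.ext hr.symm, map_smul, hσ₀x,
      smul_zero]
  let σ : maximalIdeal (R ⧸ Ideal.span {x}) →ₗ[R] QuotSMulTop x (maximalIdeal R) :=
    (LinearMap.ker ρ).liftQ σ₀ hker ∘ₗ (ρ.quotKerEquivOfSurjective hρ).symm.toLinearMap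
  let π : QuotSMulTop x (maximalIdeal R) →ₗ[R] maximalIdeal (R ⧸ Ideal.span {x}) :=
    Submodule.liftQ _ ρ (by
      intro y hy
      obtain ⟨w, -, rfl⟩ := (Submodule.mem_smul_pointwise_iff_exists _ _ _).mp hy
      refine Subtype.ext (Ideal.Quotient.eq_zero_iff_mem.mpr ?_)
      exact Ideal.mul_mem_right _ _ (Ideal.mem_span_singleton_self x))
  have hπt : ∀ a, π (t a) = 0 := by
    intro a
    obtain ⟨r, rfl⟩ := Ideal.Quotient.mk_surjective a
    change π (r • q ⟨x, hx⟩) = 0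
    rw [map_smul]
    change r • ρ ⟨x, hx⟩ = 0
    rw [hρx, smul_zero]
  refine h.of_retract
    (σ.extendScalarsOfSurjective (Ideal.Quotient.mk_surjective (I := Ideal.span {x})))
    (π.extendScalarsOfSurjective (Ideal.Quotient.mk_surjective (I := Ideal.span {x}))) ?_
  refine LinearMap.ext fun z ↦ ?_
  obtain ⟨y, rfl⟩ := hρ z
  have hσ : σ (ρ y) = σ₀ y := by
    have : (ρ.quotKerEquivOfSurjective hρ).symm (ρ y) = Submodule.Quotient.mk y := by
      rw [LinearEquiv.symm_apply_eq]; rfl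
    change (LinearMap.ker ρ).liftQ σ₀ hker ((ρ.quotKerEquivOfSurjective hρ).symm (ρ y)) = _
    rw [this]; rfl
  change π (σ (ρ y)) = ρ y
  rw [hσ]
  change π (q y - t (l y)) = ρ y
  rw [map_sub]
  exact (congrArg (π (q y) - ·) (hπt (l y))).trans (sub_zero _)

end Serre

/-- A Noetherian local ring whose maximal ideal has finite projective dimension is regular. -/
theorem IsRegularLocalRing.of_projDimLE (R : Type u) [CommRing R] [IsLocalRing R]
    [IsNoetherianRing R] {n : ℕ} (h : ProjDimLE R (maximalIdeal R) n) :
    IsRegularLocalRing R := by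
  obtain ⟨d, hd⟩ : ∃ d, (maximalIdeal R).spanFinrank ≤ d := ⟨_, le_rfl⟩
  induction d generalizing R with
  | zero =>
    refine .of_spanFinrank_maximalIdeal_le _ ?_
    rw [Nat.le_zero.mp hd]
    exact ringKrullDim_nonneg_of_nontrivial
  | succ d ih =>
    by_cases hm : maximalIdeal R = ⊥
    · exact ih R h (by simp [hm])
    obtain ⟨x, hx, hx2, hreg⟩ := exists_isSMulRegular_notMem_sq h hm
    have := IsLocalRing.quotient_span_singleton hx
    have hR := ih (R ⧸ Ideal.span {x})
      (((projDimLE_quotSMulTop_iff hx hreg (hreg.submodule _ _) n).mp h).maximalIdeal_quotient hx hx2)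
      (by have := spanFinrank_maximalIdeal_quotient_add_one_le hx hx2; lia)
    refine .of_spanFinrank_maximalIdeal_le _ ?_
    rw [← ringKrullDim_quotient_span_singleton_succ_eq_ringKrullDim hreg hx,
      ← (isRegularLocalRing_iff _).mp hR]
    exact_mod_cast spanFinrank_maximalIdeal_le_quotient_add_one x

/-- The localization of an ideal as a module is its extension to the localized ring. -/
noncomputable def Ideal.localizedModuleEquivMap {R : Type*} [CommRing R] (S : Submonoid R)
    (I : Ideal R) :
    LocalizedModule S I ≃ₗ[Localization S] I.map (algebraMap R (Localization S)) :=
  (IsLocalizedModule.linearEquiv S (LocalizedModule.mkLinearMap S I)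
    (Algebra.idealMap (Localization S) I)).extendScalarsOfIsLocalization S (Localization S)

theorem ProjDimLE.localizedModule {R : Type u} [CommRing R] {M : Type u} [AddCommGroup M]
    [Module R M] {n : ℕ} (h : ProjDimLE R M n) (S : Submonoid R) :
    ProjDimLE (Localization S) (LocalizedModule S M) n :=
  ProjDimLE.of_equiv (M := Shrink.{u} (LocalizedModule S M))
    (ModuleCat.localizedModule_hasProjectiveDimensionLE n S (ModuleCat.of R M))
    (Shrink.linearEquiv.{u} (Localization S) (LocalizedModule S M))

theorem IsRegularLocalRing.localization_atPrime {R : Type u} [CommRing R] [IsRegularLocalRing R]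
    (p : Ideal R) [p.IsPrime] : IsRegularLocalRing (Localization.AtPrime p) := by
  obtain ⟨n, hn⟩ := IsRegularLocalRing.exists_projDimLE R p
  have h := (hn.localizedModule p.primeCompl).of_equiv (p.localizedModuleEquivMap p.primeCompl)
  refine .of_projDimLE _ (n := n) (h.of_equiv (LinearEquiv.ofEq _ _ ?_))
  exact Localization.AtPrime.map_eq_maximalIdeal

theorem IsRegularLocalRing.of_isLocalization_atPrime {R : Type u} [CommRing R]
    [IsRegularLocalRing R] (p : Ideal R) [p.IsPrime] (A : Type*) [CommRing A] [Algebra R A]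
    [IsLocalization.AtPrime A p] : IsRegularLocalRing A :=
  have := IsRegularLocalRing.localization_atPrime p
  .of_ringEquiv (IsLocalization.algEquiv p.primeCompl (Localization.AtPrime p) A).toRingEquiv

theorem Ideal.isPrincipal_map_of_mem_minimalPrimes {R A : Type*} [CommRing R] [CommRing A]
    [IsDomain A] [UniqueFactorizationMonoid A] [Algebra R A] (T : Submonoid R)
    [IsLocalization T A] {P : Ideal R} {a : R} (ha : algebraMap R A a ≠ 0)
    (hP : P ∈ (Ideal.span {a}).minimalPrimes) : (P.map (algebraMap R A)).IsPrincipal := by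
  have := hP.1.1
  have haP : a ∈ P := hP.1.2 (Ideal.mem_span_singleton_self a)
  by_cases hd : Disjoint (T : Set R) P
  · have hprime := IsLocalization.isPrime_of_isPrime_disjoint T A P ‹_› hd
    obtain ⟨s, hs, hsa⟩ := UniqueFactorizationMonoid.exists_prime_factors _ ha
    have hmem : s.prod ∈ P.map (algebraMap R A) := by
      obtain ⟨c, hc⟩ := hsa.symm.dvd
      exact hc ▸ Ideal.mul_mem_right _ _ (Ideal.mem_map_of_mem _ haP)
    obtain ⟨π, hπs, hπ⟩ := (hprime.multiset_prod_mem_iff_exists_mem s).mp hmem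
    have hπspan : (Ideal.span {π}).IsPrime :=
      (Ideal.span_singleton_prime (hs π hπs).ne_zero).mpr (hs π hπs)
    have hle : P ≤ (Ideal.span {π}).under R := by
      refine hP.2 ⟨inferInstance, ?_⟩ ?_
      · rw [Ideal.span_singleton_le_iff_mem, Ideal.mem_comap, Ideal.mem_span_singleton]
        exact (Multiset.dvd_prod hπs).trans hsa.dvd
      · rw [← IsLocalization.under_map_of_isPrime_disjoint T A ‹_› hd]
        exact Ideal.comap_mono ((Ideal.span_singleton_le_iff_mem _).mpr hπ)
    refine ⟨π, le_antisymm ?_ ((Ideal.span_singleton_le_iff_mem _).mpr hπ)⟩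
    exact Ideal.map_le_iff_le_comap.mpr hle
  · rw [not_ne_iff.mp (mt (IsLocalization.map_algebraMap_ne_top_iff_disjoint T A P).mp hd)]
    infer_instance

theorem Submodule.IsPrincipal.projective {A : Type*} [CommRing A] [IsDomain A] (I : Ideal A)
    [hI : I.IsPrincipal] : Module.Projective A I := by
  obtain ⟨g, rfl⟩ := hI
  by_cases hg : g = 0
  · subst hg
    have : Subsingleton (Submodule.span A {(0 : A)}) := by
      rw [Submodule.subsingleton_iff_eq_bot]; simp
    infer_instance
  · exact .of_equiv (LinearEquiv.toSpanNonzeroSingleton A A g hg)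

/-- A prime ideal not containing the prime element `x` is principal if its extension to `R[1/x]`
is. -/
theorem Ideal.isPrincipal_of_isPrincipal_map_away {R : Type*} [CommRing R] [IsDomain R]
    [IsNoetherianRing R] {x : R} (hx : Prime x) (A : Type*) [CommRing A] [Algebra R A]
    [IsLocalization.Away x A] (P : Ideal R) [P.IsPrime] (hxP : x ∉ P)
    (h : (P.map (algebraMap R A)).IsPrincipal) : P.IsPrincipal := by
  by_cases hP : P = ⊥
  · subst hP; infer_instance
  have hle : Submonoid.powers x ≤ nonZeroDivisors R :=
    powers_le_nonZeroDivisors_of_noZeroDivisors hx.ne_zero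
  have hinj : Function.Injective (algebraMap R A) := IsLocalization.injective A hle
  obtain ⟨g, hg⟩ := h
  have hgP : g ∈ P.map (algebraMap R A) := hg ▸ Submodule.mem_span_singleton_self g
  obtain ⟨⟨⟨p, hp⟩, s⟩, hgs⟩ :=
    (IsLocalization.mem_map_algebraMap_iff (Submonoid.powers x) A).mp hgP
  have hgs : g * algebraMap R A s = algebraMap R A p := hgs
  have hdvd : ∀ y ∈ P, algebraMap R A p ∣ algebraMap R A y := by
    intro y hy
    have : algebraMap R A y ∈ P.map (algebraMap R A) := Ideal.mem_map_of_mem _ hy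
    rw [hg] at this
    rw [← hgs, (IsLocalization.map_units A s).mul_right_dvd]
    exact Ideal.mem_span_singleton.mp this
  have hp0 : p ≠ 0 := by
    rintro rfl
    refine hP ((Submodule.eq_bot_iff _).mpr fun y hy ↦ ?_)
    have := hdvd y hy
    rw [map_zero, zero_dvd_iff] at this
    exact (map_eq_zero_iff _ hinj).mp this
  obtain ⟨p', hpp', hxp'⟩ :=
    (FiniteMultiplicity.of_not_isUnit hx.not_isUnit hp0).exists_eq_pow_mul_and_not_dvd
  have hp'P : p' ∈ P := by
    rw [hpp'] at hp
    exact (Ideal.IsPrime.mem_or_mem ‹_› hp).resolve_left fun h ↦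
      hxP (Ideal.IsPrime.mem_of_pow_mem ‹_› _ h)
  refine ⟨p', le_antisymm (fun y hy ↦ ?_) ((Ideal.span_singleton_le_iff_mem _).mpr hp'P)⟩
  obtain ⟨c, hc⟩ : algebraMap R A p' ∣ algebraMap R A y :=
    (map_dvd (algebraMap R A) (Dvd.intro_left _ hpp'.symm)).trans (hdvd y hy)
  obtain ⟨⟨b, ⟨_, k, rfl⟩⟩, hb⟩ := IsLocalization.surj (Submonoid.powers x) c
  have hb : c * algebraMap R A (x ^ k) = algebraMap R A b := hb
  have hyb : x ^ k * y = p' * b := hinj (by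
    rw [map_mul, map_mul, hc, ← hb]; ring)
  obtain ⟨e, rfl⟩ := hx.pow_dvd_of_dvd_mul_left k hxp' (Dvd.intro _ hyb)
  refine Ideal.mem_span_singleton.mpr ⟨e, mul_left_cancel₀ (pow_ne_zero k hx.ne_zero) ?_⟩
  rw [hyb]; ring

/-- **Auslander–Buchsbaum theorem**: a regular local ring is a unique factorization domain. -/
theorem IsRegularLocalRing.uniqueFactorizationMonoid (R : Type u) [CommRing R]
    [IsRegularLocalRing R] [IsDomain R] : UniqueFactorizationMonoid R := by
  obtain ⟨n, hn⟩ : ∃ n : ℕ, ringKrullDim R < n :=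
    ⟨(maximalIdeal R).spanFinrank + 1, by
      rw [← (isRegularLocalRing_iff R).mp inferInstance]; exact_mod_cast Nat.lt_succ_self _⟩
  induction n generalizing R with
  | zero => exact absurd hn (not_lt.mpr ringKrullDim_nonneg_of_nontrivial)
  | succ n ih =>
    rw [UniqueFactorizationMonoid.iff_exists_prime_mem_of_isPrime]
    intro P₀ hP₀ hP₀prime
    by_cases hm : maximalIdeal R ≤ maximalIdeal R ^ 2
    · have := maximalIdeal_eq_bot_of_le_sq hm
      exact absurd (eq_bot_iff.mpr (this ▸ le_maximalIdeal hP₀prime.ne_top)) hP₀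
    obtain ⟨x, hx, hx2⟩ := SetLike.not_le_iff_exists.mp hm
    have hxprime := IsRegularLocalRing.prime_of_notMem_sq hx hx2
    obtain ⟨a, ha, ha0⟩ := Submodule.exists_mem_ne_zero_of_ne_bot hP₀
    obtain ⟨P, hP, hPP₀⟩ := Ideal.exists_minimalPrimes_le
      ((Ideal.span_singleton_le_iff_mem P₀).mpr ha)
    have hPprime := hP.1.1
    have hP0 : P ≠ ⊥ := by
      rintro rfl
      exact ha0 (hP.1.2 (Ideal.mem_span_singleton_self a))
    by_cases hxP : x ∈ P
    · exact ⟨x, hPP₀ hxP, hxprime⟩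
    suffices h : P.IsPrincipal by
      obtain ⟨p, rfl⟩ := h
      have hp0 : p ≠ 0 := by rintro rfl; simp at hP0
      exact ⟨p, hPP₀ (Ideal.mem_span_singleton_self p), (Ideal.span_singleton_prime hp0).mp hPprime⟩
    let A := Localization (Submonoid.powers x)
    have hle : Submonoid.powers x ≤ nonZeroDivisors R :=
      powers_le_nonZeroDivisors_of_noZeroDivisors hxprime.ne_zero
    have : IsDomain A := IsLocalization.isDomain_localization hle
    have : IsNoetherianRing A :=
      IsLocalization.isNoetherianRing (Submonoid.powers x) A inferInstance
    refine Ideal.isPrincipal_of_isPrincipal_map_away hxprime A P hxP ?_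
    have hproj : Module.Projective A (P.map (algebraMap R A)) := by
      have := Module.finitePresentation_of_finite A (P.map (algebraMap R A))
      refine Module.projective_of_localization_maximal fun q hq ↦ ?_
      have hdom : IsDomain (Localization.AtPrime q) :=
        IsLocalization.isDomain_localization q.primeCompl_le_nonZeroDivisors
      have hloc := IsLocalization.isLocalization_isLocalization_atPrime_isLocalization
        (Submonoid.powers x) (Localization.AtPrime q) q
      have hreg := IsRegularLocalRing.of_isLocalization_atPrime (q.comap (algebraMap R A))
        (Localization.AtPrime q)
      have hxq : x ∉ q.comap (algebraMap R A) := fun h ↦ hq.ne_top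
        (q.eq_top_of_isUnit_mem h (IsLocalization.map_units A ⟨x, Submonoid.mem_powers x⟩))
      have hlt : q.comap (algebraMap R A) < maximalIdeal R :=
        lt_of_le_of_ne (le_maximalIdeal (Ideal.IsPrime.ne_top inferInstance))
          fun h ↦ hxq (h ▸ hx)
      have hufd := ih (Localization.AtPrime q) (by
        rw [IsLocalization.AtPrime.ringKrullDim_eq_height (q.comap (algebraMap R A))]
        refine lt_of_lt_of_le (WithBot.coe_lt_coe.mpr
          (Ideal.height_strict_mono_of_isPrime_of_isPrime hlt)) ?_
        rw [maximalIdeal_height_eq_ringKrullDim]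
        exact ENat.WithBot.lt_add_one_iff.mp (by exact_mod_cast hn))
      have hprin : ((P.map (algebraMap R A)).map
          (algebraMap A (Localization.AtPrime q))).IsPrincipal := by
        rw [Ideal.map_map, ← IsScalarTower.algebraMap_eq]
        refine Ideal.isPrincipal_map_of_mem_minimalPrimes (q.comap (algebraMap R A)).primeCompl
          ?_ hP
        rw [IsScalarTower.algebraMap_apply R A]
        refine (map_ne_zero_iff _ ?_).mpr ((map_ne_zero_iff _ ?_).mpr ha0)
        · exact IsLocalization.injective _ q.primeCompl_le_nonZeroDivisors
        · exact IsLocalization.injective _ hle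
      have := Submodule.IsPrincipal.projective
        ((P.map (algebraMap R A)).map (algebraMap A (Localization.AtPrime q)))
      exact .of_equiv ((P.map (algebraMap R A)).localizedModuleEquivMap q.primeCompl).symm
    have e := P.localizedModuleEquivMap (Submonoid.powers x)
    have : Module.Projective A (LocalizedModule (Submonoid.powers x) P) := .of_equiv e.symm
    obtain ⟨d, hd⟩ := IsRegularLocalRing.exists_projDimLE R P
    have := hd.isStablyFree_localizedModule (Submonoid.powers x)
    obtain ⟨N, _, _, _, _, _⟩ := Module.IsStablyFree.exist_free_prod A
      (LocalizedModule (Submonoid.powers x) P)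
    have : Module.Free A (P.map (algebraMap R A) × N) :=
      .of_equiv (e.prodCongr (LinearEquiv.refl A N))
    exact Ideal.isPrincipal_of_free_prod _ N

/-- A commutative Noetherian regular local ring (regularity expressed as:
the Krull dimension equals the dimension of the cotangent space over the
residue field) is a unique factorization domain (Auslander–Buchsbaum). -/
theorem regular_local_ring_is_UFD (R : Type*) [CommRing R] [IsNoetherianRing R]
    [IsLocalRing R]
    (hreg : ringKrullDim R =
      (Module.finrank (IsLocalRing.ResidueField R) (IsLocalRing.CotangentSpace R) : ℕ)) :
    IsDomain R ∧ ∀ [IsDomain R], UniqueFactorizationMonoid R := by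
  have : IsRegularLocalRing R := (IsRegularLocalRing.iff_finrank_cotangentSpace R).mpr hreg.symm
  exact ⟨IsRegularLocalRing.isDomain R, IsRegularLocalRing.uniqueFactorizationMonoid R⟩
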